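/- Let α_n be the effective resistance across the first rung of the ladder graph P_2 □ P_n. For 1 < k < n, the effective resistance across the k-th rung of P_2 □ P_n (i.e., between (1,k) and (2,k)) equals 1 / (1 + 1/(α_{k−1} + 2) + 1/(α_{n−k} + 2)). -/

import Mathlib

open Classical Matrix

/-- The four Penrose conditions characterizing the Moore–Penrose pseudoinverse
of a real square matrix. -/
def IsMoorePenroseInverse {V : Type*} [Fintype V] [DecidableEq V]
    (L P : Matrix V V ℝ) : Prop :=
  L * P * L = L ∧ P * L * P = P ∧ (L * P)ᵀ = L * P ∧ (P * L)ᵀ = P * L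

/-- The Moore–Penrose pseudoinverse of a real square matrix. -/
noncomputable def pinv {V : Type*} [Fintype V] [DecidableEq V]
    (L : Matrix V V ℝ) : Matrix V V ℝ :=
  if h : ∃ P, IsMoorePenroseInverse L P then h.choose else 0

/-- Effective resistance between `x` and `y` computed from a (weighted) Laplacian `L`. -/
noncomputable def effResM {V : Type*} [Fintype V] [DecidableEq V]
    (L : Matrix V V ℝ) (x y : V) : ℝ :=
  pinv L x x + pinv L y y - 2 * pinv L x y

/-- Effective resistance between vertices `x` and `y` of a simple graph `G`. -/
noncomputable def effRes {V : Type*} [Fintype V] [DecidableEq V]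
    (G : SimpleGraph V) (x y : V) : ℝ :=
  effResM (G.lapMatrix ℝ) x y

/-- The node resistance curvature `p_x = 1 - (1/2) ∑_{y ~ x} ω_{x,y}`. -/
noncomputable def curv {V : Type*} [Fintype V] [DecidableEq V]
    (G : SimpleGraph V) (x : V) : ℝ :=
  1 - (1/2) * ∑ y : V, if G.Adj x y then effRes G x y else 0

/-- The grid graph `P_m □ P_n` (vertex `(i,j)` of the paper corresponds to
`(⟨i-1⟩, ⟨j-1⟩) : Fin m × Fin n`). -/
def grid (m n : ℕ) : SimpleGraph (Fin m × Fin n) :=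
  (SimpleGraph.pathGraph m).boxProd (SimpleGraph.pathGraph n)

/-- The ladder graph `P_2 □ P_n` (vertex `(i,k)` of the paper corresponds to
`(⟨i-1⟩, ⟨k-1⟩) : Fin 2 × Fin n`). -/
def ladder (n : ℕ) : SimpleGraph (Fin 2 × Fin n) :=
  (SimpleGraph.pathGraph 2).boxProd (SimpleGraph.pathGraph n)

/-- `α_n`, the effective resistance across the first rung of the ladder `P_2 □ P_n`,
i.e. between the vertices `(1,1)` and `(2,1)` of the paper (junk value `0` for `n = 0`). -/
noncomputable def alpha (n : ℕ) : ℝ :=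
  if h : 0 < n then effRes (ladder n) (0, ⟨0, h⟩) (1, ⟨0, h⟩) else 0

theorem mp_exists {V : Type*} [Fintype V] [DecidableEq V] (L : Matrix V V ℝ) (hL : Lᵀ = L) :
    ∃ P, IsMoorePenroseInverse L P := by
  have hH : L.IsHermitian := by
    rw [Matrix.IsHermitian, Matrix.conjTranspose_eq_transpose_of_trivial, hL]
  obtain ⟨U, D, h1, h2⟩ : ∃ (U : Matrix V V ℝ) (d : V → ℝ), Uᵀ * U = 1 ∧
      L = U * Matrix.diagonal d * Uᵀ := by
    refine ⟨hH.eigenvectorUnitary, hH.eigenvalues, ?_, ?_⟩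
    · have := Unitary.coe_star_mul_self hH.eigenvectorUnitary
      rwa [Matrix.star_eq_conjTranspose, Matrix.conjTranspose_eq_transpose_of_trivial] at this
    · have := hH.spectral_theorem
      rw [Unitary.conjStarAlgAut_apply] at this
      rw [Matrix.star_eq_conjTranspose, Matrix.conjTranspose_eq_transpose_of_trivial] at this
      exact this
  have key : ∀ a b : V → ℝ, (U * diagonal a * Uᵀ) * (U * diagonal b * Uᵀ)
      = U * diagonal (fun i => a i * b i) * Uᵀ := by
    intro a b
    calc _ = U * diagonal a * (Uᵀ * U) * diagonal b * Uᵀ := by simp only [Matrix.mul_assoc]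
      _ = _ := by rw [h1, Matrix.mul_one, Matrix.mul_assoc U, Matrix.diagonal_mul_diagonal]
  have ht : ∀ a : V → ℝ, (U * diagonal a * Uᵀ)ᵀ = U * diagonal a * Uᵀ := by
    intro a
    simp [Matrix.transpose_mul, Matrix.mul_assoc]
  refine ⟨U * diagonal (fun i => (D i)⁻¹) * Uᵀ, ?_, ?_, ?_, ?_⟩
  · rw [h2, key, key]; congr; funext i; exact mul_inv_mul_cancel (D i)
  · rw [h2, key, key]; congr; funext i
    by_cases h : D i = 0 <;> simp [h]
  · rw [h2, key, ht]
  · rw [h2, key, ht]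

theorem mp_unique {V : Type*} [Fintype V] [DecidableEq V] (L P Q : Matrix V V ℝ)
    (hP : IsMoorePenroseInverse L P) (hQ : IsMoorePenroseInverse L Q) : P = Q := by
  obtain ⟨p1, p2, p3, p4⟩ := hP
  obtain ⟨q1, q2, q3, q4⟩ := hQ
  have e1 : L * P = L * Q := by
    calc L * P = (L * P)ᵀ := p3.symm
      _ = ((L * Q) * (L * P))ᵀ := by rw [← Matrix.mul_assoc, q1]
      _ = (L * P) * (L * Q) := by rw [Matrix.transpose_mul, p3, q3]
      _ = L * Q := by rw [← Matrix.mul_assoc, p1]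
  have e2 : P * L = Q * L := by
    calc P * L = (P * L)ᵀ := p4.symm
      _ = ((P * L) * (Q * L))ᵀ := by rw [Matrix.mul_assoc P, ← Matrix.mul_assoc L, q1]
      _ = (Q * L) * (P * L) := by rw [Matrix.transpose_mul, p4, q4]
      _ = Q * L := by rw [Matrix.mul_assoc Q, ← Matrix.mul_assoc L, p1]
  calc P = P * L * P := p2.symm
    _ = Q * (L * P) := by rw [e2, Matrix.mul_assoc]
    _ = Q := by rw [e1, ← Matrix.mul_assoc, q2]

theorem effResM_eq {V : Type*} [Fintype V] [DecidableEq V] (L : Matrix V V ℝ) (hL : Lᵀ = L)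
    (x y : V) (v : V → ℝ) (hv : L *ᵥ v = Pi.single x 1 - Pi.single y 1) :
    effResM L x y = v x - v y := by
  have hex := mp_exists L hL
  have hP : IsMoorePenroseInverse L (pinv L) := by
    unfold pinv; rw [dif_pos hex]; exact hex.choose_spec
  have hs : (pinv L)ᵀ = pinv L := by
    apply mp_unique L _ _ _ hP
    obtain ⟨p1, p2, p3, p4⟩ := hP
    have a : L * (pinv L)ᵀ = pinv L * L := by rw [← p4, Matrix.transpose_mul, hL]
    have b : (pinv L)ᵀ * L = L * pinv L := by rw [← p3, Matrix.transpose_mul, hL]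
    refine ⟨?_, ?_, ?_, ?_⟩
    · have := congrArg Matrix.transpose p1
      rwa [Matrix.transpose_mul, Matrix.transpose_mul, hL, ← Matrix.mul_assoc] at this
    · have := congrArg Matrix.transpose p2
      rwa [Matrix.transpose_mul, Matrix.transpose_mul, hL, ← Matrix.mul_assoc] at this
    · rw [a, p4]
    · rw [b, p3]
  have hxy : pinv L y x = pinv L x y := by
    conv_lhs => rw [← hs]
    rfl
  have h1 : (L *ᵥ v) ⬝ᵥ (pinv L *ᵥ (L *ᵥ v)) = v ⬝ᵥ (L *ᵥ v) := by
    rw [Matrix.dotProduct_mulVec, Matrix.dotProduct_mulVec, ← Matrix.mulVec_transpose]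
    rw [← Matrix.mulVec_transpose, hL, hs]
    simp only [Matrix.mulVec_mulVec]
    rw [← Matrix.mul_assoc, hP.1, dotProduct_comm]
  rw [hv] at h1
  simp [Matrix.mulVec_sub, sub_dotProduct, dotProduct_sub, Matrix.mulVec_single] at h1
  unfold effResM
  linarith

theorem lap_apply {V : Type*} [Fintype V] [DecidableEq V] (G : SimpleGraph V)
    [DecidableRel G.Adj] (v : V → ℝ) (x : V) :
    (G.lapMatrix ℝ *ᵥ v) x = ∑ y, if G.Adj x y then v x - v y else 0 := by
  rw [SimpleGraph.lapMatrix_mulVec_apply, ← Finset.sum_filter, Finset.sum_sub_distrib]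
  simp [SimpleGraph.neighborFinset_eq_filter, ← SimpleGraph.card_neighborFinset_eq_degree]

/-- `(u_p, d_p)` with `u_0 = 1`, `d_0 = 0`, `d_{p+1} = 2 u_p + d_p`, `u_{p+1} = u_p + d_{p+1}`. -/
noncomputable def ud : ℕ → ℝ × ℝ
  | 0 => (1, 0)
  | p + 1 => ((ud p).1 + (2 * (ud p).1 + (ud p).2), 2 * (ud p).1 + (ud p).2)

theorem ud_pos (p : ℕ) : 0 < (ud p).1 ∧ 0 ≤ (ud p).2 := by
  induction p with
  | zero => simp [ud]
  | succ p ih => simp only [ud]; constructor <;> linarith [ih.1, ih.2]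

/-- The unnormalised potential. -/
noncomputable def pot (p q j : ℕ) : ℝ :=
  if j ≤ p then (ud j).1 * (ud q).1 else (ud p).1 * (ud (p + q - j)).1

theorem path_sum (n : ℕ) (F : ℕ → ℝ) (j : Fin n) :
    (∑ i : Fin n, if (SimpleGraph.pathGraph n).Adj j i then F j - F i else 0)
      = (if (j : ℕ) + 1 < n then F j - F (j + 1) else 0)
        + (if 0 < (j : ℕ) then F j - F (j - 1) else 0) := by
  have : ∀ i : Fin n, (if (SimpleGraph.pathGraph n).Adj j i then F j - F i else 0)
      = (fun i : ℕ => (if i = (j : ℕ) + 1 then F j - F i else 0)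
        + (if 0 < (j : ℕ) ∧ i = (j : ℕ) - 1 then F j - F i else 0)) i := by
    intro i
    simp only [SimpleGraph.pathGraph_adj]
    split_ifs <;> first | omega | simp
  rw [Finset.sum_congr rfl (fun i _ => this i), Fin.sum_univ_eq_sum_range
    (fun i : ℕ => (if i = (j : ℕ) + 1 then F j - F i else 0)
        + (if 0 < (j : ℕ) ∧ i = (j : ℕ) - 1 then F j - F i else 0)) n, Finset.sum_add_distrib]
  congr 1
  · simp
  · by_cases h : 0 < (j : ℕ)
    · have : (j : ℕ) - 1 < n := by omega
      simp [h]
      intro; omega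
    · simp [h]

theorem pot_eq (p q j : ℕ) (hj : j < p + q + 1) :
    2 * pot p q j + ((if j + 1 < p + q + 1 then pot p q j - pot p q (j + 1) else 0)
        + (if 0 < j then pot p q j - pot p q (j - 1) else 0))
      = if j = p then 2 * (ud p).1 * (ud q).1 + (ud p).2 * (ud q).1 + (ud p).1 * (ud q).2
        else 0 := by
  have left : ∀ i, i ≤ p → pot p q i = (ud i).1 * (ud q).1 := fun i hi => if_pos hi
  have right : ∀ i, i ≤ q → pot p q (p + q - i) = (ud p).1 * (ud i).1 := by
    intro i hi
    unfold pot
    split_ifs with h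
    · have : i = q := by omega
      subst this; simp
    · congr 3; omega
  -- difference towards the left end, for indices at most `p`
  have dl : ∀ i, i ≤ p → (if 0 < i then pot p q i - pot p q (i - 1) else 0)
      = (ud i).2 * (ud q).1 := by
    intro i hi
    cases i with
    | zero => simp [ud]
    | succ i =>
      rw [if_pos (Nat.succ_pos i), left _ hi, Nat.add_sub_cancel, left _ (by omega)]
      simp only [ud]; ring
  have dr : ∀ i, i ≤ q → (if (p + q - i) + 1 < p + q + 1
      then pot p q (p + q - i) - pot p q (p + q - i + 1) else 0)
      = (ud p).1 * (ud i).2 := by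
    intro i hi
    cases i with
    | zero => simp [ud]
    | succ i =>
      rw [if_pos (by omega), right _ hi, show p + q - (i + 1) + 1 = p + q - i by omega,
        right _ (by omega)]
      simp only [ud]; ring
  rcases lt_trichotomy j p with h | h | h
  · rw [dl j h.le, if_pos (by omega), if_neg h.ne, left j h.le, left (j + 1) h]
    simp only [ud]; ring
  · subst h
    have := dr q le_rfl
    rw [Nat.add_sub_cancel] at this
    rw [this, dl j le_rfl, if_pos rfl, left j le_rfl]
    ring
  · obtain ⟨i, hi, rfl⟩ : ∃ i, i < q ∧ j = p + q - i := ⟨p + q - j, by omega, by omega⟩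
    rw [dr i hi.le, if_pos (by omega), if_neg (by omega), right i hi.le,
      show p + q - i - 1 = p + q - (i + 1) by omega, right (i + 1) hi]
    simp only [ud]; ring

theorem ladder_effRes (n p q : ℕ) (hn : n = p + q + 1) (hp : p < n) :
    effRes (ladder n) (0, ⟨p, hp⟩) (1, ⟨p, hp⟩)
      = 2 * (ud p).1 * (ud q).1 /
        (2 * (ud p).1 * (ud q).1 + (ud p).2 * (ud q).1 + (ud p).1 * (ud q).2) := by
  obtain ⟨a1, a2⟩ := ud_pos p
  obtain ⟨b1, b2⟩ := ud_pos q
  set C := 2 * (ud p).1 * (ud q).1 + (ud p).2 * (ud q).1 + (ud p).1 * (ud q).2 with hC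
  have hCpos : 0 < C := by positivity
  have hsum : ∀ j : Fin n, 2 * pot p q j + (∑ i : Fin n,
      if (SimpleGraph.pathGraph n).Adj j i then pot p q j - pot p q i else 0)
      = if (j : ℕ) = p then C else 0 := by
    intro j
    rw [path_sum]
    have := pot_eq p q j (by omega)
    rw [← hn] at this
    exact this
  unfold effRes
  rw [effResM_eq _ (SimpleGraph.isSymm_lapMatrix ℝ _) _ _
    (fun z : Fin 2 × Fin n => (if z.1 = 0 then 1 else -1) * (pot p q z.2 / C))]
  · simp only [pot, le_refl, if_true]
    simp
    ring
  · funext ⟨s, j⟩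
    rw [lap_apply, Fintype.sum_prod_type, Fin.sum_univ_two]
    have h := hsum j
    simp only [ladder, SimpleGraph.boxProd_adj, SimpleGraph.pathGraph_adj] at h ⊢
    have h' : 2 * (pot p q j / C) + (∑ i : Fin n,
      if (j : ℕ) + 1 = i ∨ (i : ℕ) + 1 = j then pot p q j / C - pot p q i / C else 0)
      = if j = ⟨p, hp⟩ then 1 else 0 := by
      have e : (if j = ⟨p, hp⟩ then (1 : ℝ) else 0) = (if (j : ℕ) = p then C else 0) / C := by
        simp only [Fin.ext_iff]
        split_ifs
        · exact (div_self hCpos.ne').symm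
        · simp
      rw [e, ← h, add_div, Finset.sum_div]
      congr 1
      · ring
      · refine Finset.sum_congr rfl fun i _ => ?_
        split_ifs
        · ring
        · simp
    have h'' : -(2 * (pot p q j / C)) + (∑ i : Fin n,
      if (j : ℕ) + 1 = i ∨ (i : ℕ) + 1 = j then -(pot p q j / C) + pot p q i / C else 0)
      = - if j = ⟨p, hp⟩ then 1 else 0 := by
      rw [← h', neg_add, ← Finset.sum_neg_distrib]
      congr 1
      refine Finset.sum_congr rfl fun i _ => ?_
      split_ifs
      · ring
      · simp
    fin_cases s
    · simp [Pi.single_apply]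
      rw [← h']
      ring
    · simp [Pi.single_apply]
      linarith [h'']

theorem rung_effres (n k : ℕ) (hk1 : 1 < k) (hkn : k < n) :
    effRes (ladder n) (0, ⟨k - 1, by omega⟩) (1, ⟨k - 1, by omega⟩)
      = 1 / (1 + 1 / (alpha (k - 1) + 2) + 1 / (alpha (n - k) + 2)) := by
  have ha : ∀ m, alpha (m + 1) = 2 * (ud m).1 / (2 * (ud m).1 + (ud m).2) := by
    intro m
    unfold alpha
    rw [dif_pos (Nat.succ_pos m), ladder_effRes (m + 1) 0 m (by omega)]
    simp [ud]
  obtain ⟨a, rfl⟩ : ∃ a, k = a + 2 := ⟨k - 2, by omega⟩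
  obtain ⟨b, rfl⟩ : ∃ b, n = a + 2 + (b + 1) := ⟨n - (a + 3), by omega⟩
  rw [ladder_effRes _ (a + 2 - 1) (b + 1) (by omega)]
  rw [show a + 2 - 1 = a + 1 by omega, show a + 2 + (b + 1) - (a + 2) = b + 1 by omega, ha, ha]
  obtain ⟨a1, a2⟩ := ud_pos a
  obtain ⟨b1, b2⟩ := ud_pos b
  simp only [ud]
  generalize (ud a).1 = x at *
  generalize (ud a).2 = x' at *
  generalize (ud b).1 = y at *
  generalize (ud b).2 = y' at *
  have e : ∀ s t : ℝ, 0 < s → 0 ≤ t → 1 / (2 * s / (2 * s + t) + 2)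
      = (2 * s + t) / (2 * (s + (2 * s + t))) := by
    intro s t hs ht
    have : 0 < 2 * s + t := by positivity
    have : 0 < s + (2 * s + t) := by positivity
    rw [div_add' _ _ _ (by positivity), one_div_div]
    congr 1; ring
  rw [e x x' a1 a2, e y y' b1 b2]
  have : 0 < x + (2 * x + x') := by positivity
  have : 0 < y + (2 * y + y') := by positivity
  rw [div_eq_div_iff (by positivity) (by positivity)]
  field_simp
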